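/- Let F^{i j̄}(y) (i,j = 1,…,n) be a Hermitian positive definite matrix-valued function on a set U, with uniform bounds 0 < c·I ≤ [F^{i j̄}(y)] ≤ C·I for all y. Then there exist a finite number N, unit vectors γ₁, …, γ_N ∈ ℂⁿ whose span contains an orthonormal basis of ℂⁿ, and continuous functions τ₁, …, τ_N : U → ℝ with 0 < C₁ ≤ τ_k(y) ≤ C₂ for all k and y, such that F^{i j̄}(y) = Σ_{k=1}^N τ_k(y) (γ_k)^i \overline{(γ_k)^j} for all y ∈ U. -/

import Mathlib

open scoped ComplexOrder

section RankOneDecomposition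

open scoped Matrix.Norms.L2Operator MatrixOrder

variable {n : ℕ}

/-- The rank-one matrix `x x^*`. -/
def rankOneMatrix (x : EuclideanSpace ℂ (Fin n)) : Matrix (Fin n) (Fin n) ℂ :=
  Matrix.vecMulVec x (star x)

lemma rankOneMatrix_apply (x : EuclideanSpace ℂ (Fin n)) (i j : Fin n) :
    rankOneMatrix x i j = x i * (starRingEnd ℂ) (x j) := rfl

lemma isStarProjection_rankOneMatrix {x : EuclideanSpace ℂ (Fin n)} (hx : ‖x‖ = 1) :
    IsStarProjection (rankOneMatrix x) := by
  have h : star (x : Fin n → ℂ) ⬝ᵥ (x : Fin n → ℂ) = 1 := by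
    have h1 := inner_self_eq_norm_sq_to_K (𝕜 := ℂ) x
    rw [EuclideanSpace.inner_eq_star_dotProduct, hx, dotProduct_comm] at h1
    simpa using h1
  constructor
  · rw [IsIdempotentElem, rankOneMatrix, Matrix.vecMulVec_mul_vecMulVec, h, one_smul]
  · ext i j
    simp [rankOneMatrix, Matrix.vecMulVec_apply, Matrix.star_apply, mul_comm]

lemma Matrix.IsHermitian.eq_sum_eigenvalues_smul_rankOneMatrix
    {A : Matrix (Fin n) (Fin n) ℂ} (hA : A.IsHermitian) :
    A = ∑ k, hA.eigenvalues k • rankOneMatrix (hA.eigenvectorBasis k) := by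
  ext i j
  conv_lhs => rw [hA.spectral_theorem]
  simp [Unitary.conjStarAlgAut_apply, Matrix.mul_apply, Matrix.sum_apply, rankOneMatrix_apply,
    Matrix.star_apply, Matrix.diagonal_apply, mul_comm]
  simp only [mul_assoc]

/-- Finitely many rank-one projections span the Hermitian matrices, with linear coefficients. -/
lemma exists_linear_rankOneMatrix_coefficients (n : ℕ) :
    ∃ (ι : Type) (_ : Fintype ι) (u : ι → EuclideanSpace ℂ (Fin n))
      (l : ι → Matrix (Fin n) (Fin n) ℂ →ₗ[ℝ] ℝ), (∀ k, ‖u k‖ = 1) ∧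
      ∀ A : Matrix (Fin n) (Fin n) ℂ, A.IsHermitian → A = ∑ k, l k A • rankOneMatrix (u k) := by
  obtain ⟨b, hbS, hspan, hli⟩ := exists_linearIndependent ℝ
    (rankOneMatrix '' {x : EuclideanSpace ℂ (Fin n) | ‖x‖ = 1})
  have hfin : Finite b := hli.finite
  have : Fintype b := Fintype.ofFinite b
  choose u hu hub using fun k : b => hbS k.2
  let B := Module.Basis.span hli
  choose l hl using fun k : b => (B.coord k).exists_extend
  have hr : Set.range ((↑) : b → Matrix (Fin n) (Fin n) ℂ) = b := Subtype.range_coe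
  refine ⟨b, inferInstance, u, l, hu, fun A hA => ?_⟩
  have hmem : A ∈ Submodule.span ℝ (Set.range ((↑) : b → Matrix (Fin n) (Fin n) ℂ)) := by
    rw [hr, hspan, hA.eq_sum_eigenvalues_smul_rankOneMatrix]
    refine Submodule.sum_mem _ fun k _ => Submodule.smul_mem _ _ (Submodule.subset_span ?_)
    exact ⟨_, hA.eigenvectorBasis.orthonormal.1 k, rfl⟩
  have h := congrArg Subtype.val (B.sum_repr ⟨A, hmem⟩)
  have h2 : ∀ k, l k A = B.repr ⟨A, hmem⟩ k := fun k =>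
    LinearMap.congr_fun (hl k) ⟨A, hmem⟩
  simp only [h2, hub]
  simpa [B, Module.Basis.span_apply] using h.symm

lemma sum_rankOneMatrix_le {ι : Type*} [Fintype ι] {u : ι → EuclideanSpace ℂ (Fin n)}
    (hu : ∀ k, ‖u k‖ = 1) {c : ℝ} (hc : 0 < c) :
    (c / (Fintype.card ι + 1)) • ∑ k, rankOneMatrix (u k) ≤ c • 1 := by
  have h1 : ∑ k, rankOneMatrix (u k) ≤ ((Fintype.card ι : ℝ) + 1) • 1 := by
    calc ∑ k, rankOneMatrix (u k) ≤ ∑ _k : ι, (1 : Matrix (Fin n) (Fin n) ℂ) :=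
          Finset.sum_le_sum fun k _ => (isStarProjection_rankOneMatrix (hu k)).le_one
      _ = (Fintype.card ι : ℝ) • 1 := by simp [← Nat.cast_smul_eq_nsmul ℝ]
      _ ≤ _ := smul_le_smul_of_nonneg_right (by linarith) zero_le_one
  calc _ ≤ (c / (Fintype.card ι + 1)) • ((Fintype.card ι : ℝ) + 1) •
        (1 : Matrix (Fin n) (Fin n) ℂ) := smul_le_smul_of_nonneg_left h1 (by positivity)
    _ = c • 1 := by rw [smul_smul, div_mul_cancel₀]; positivity

lemma isHermitian_of_smul_one_le {A : Matrix (Fin n) (Fin n) ℂ} {c : ℝ} (h : c • 1 ≤ A) :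
    A.IsHermitian := by
  have h1 := (Matrix.le_iff.1 h).isHermitian
  have h2 : (c • (1 : Matrix (Fin n) (Fin n) ℂ)).IsHermitian :=
    Matrix.isHermitian_one.smul (IsSelfAdjoint.all c)
  simpa using h1.add h2

lemma posDef_of_smul_one_le {A : Matrix (Fin n) (Fin n) ℂ} {c : ℝ} (hc : 0 < c) (h : c • 1 ≤ A) :
    A.PosDef := by
  have h2 : (c • (1 : Matrix (Fin n) (Fin n) ℂ)).PosDef := Matrix.PosDef.one.smul hc
  simpa using h2.add_posSemidef (Matrix.le_iff.1 h)

/-- Near a positive definite matrix, Hermitian matrices decompose along fixed unit directions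
with positive continuous coefficients. -/
lemma exists_pos_coefficients_at {A₀ : Matrix (Fin n) (Fin n) ℂ} {c : ℝ} (hc : 0 < c)
    (hA₀ : c • 1 ≤ A₀) :
    ∃ (ι : Type) (_ : Fintype ι) (u : ι → EuclideanSpace ℂ (Fin n))
      (f : ι → Matrix (Fin n) (Fin n) ℂ → ℝ), (∀ k, ‖u k‖ = 1) ∧ (∀ k, Continuous (f k)) ∧
      (∀ k, 0 < f k A₀) ∧
      ∀ A : Matrix (Fin n) (Fin n) ℂ, A.IsHermitian → A = ∑ k, f k A • rankOneMatrix (u k) := by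
  obtain ⟨ι, _, u, l, hu, hl⟩ := exists_linear_rankOneMatrix_coefficients n
  set ε : ℝ := c / 2 / (Fintype.card ι + 1)
  have hε0 : 0 < ε := by positivity
  set R := A₀ - ε • ∑ k, rankOneMatrix (u k) with hR
  have hRc : (c / 2) • 1 ≤ R := by
    rw [hR, le_sub_iff_add_le]
    calc _ ≤ (c / 2) • 1 + (c / 2) • (1 : Matrix (Fin n) (Fin n) ℂ) :=
          add_le_add_right (sum_rankOneMatrix_le hu (by positivity)) _
      _ = c • 1 := by rw [← add_smul, add_halves]
      _ ≤ A₀ := hA₀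
  have hRpos := posDef_of_smul_one_le (by positivity) hRc
  refine ⟨ι ⊕ Fin n, inferInstance, Sum.elim u hRpos.isHermitian.eigenvectorBasis,
    Sum.elim (fun k A => ε + l k (A - A₀)) (fun k _ => hRpos.isHermitian.eigenvalues k),
    ?_, ?_, ?_, ?_⟩
  · rintro (k | k)
    · exact hu k
    · exact hRpos.isHermitian.eigenvectorBasis.orthonormal.1 k
  · rintro (k | k)
    · have := (l k).continuous_of_finiteDimensional
      simp only [Sum.elim_inl]
      fun_prop
    · exact continuous_const
  · rintro (k | k)
    · simpa using hε0
    · exact hRpos.eigenvalues_pos k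
  · intro A hA
    simp only [Fintype.sum_sum_type, Sum.elim_inl, Sum.elim_inr, add_smul, Finset.sum_add_distrib]
    rw [← hl _ (hA.sub (isHermitian_of_smul_one_le hA₀)),
      ← hRpos.isHermitian.eq_sum_eigenvalues_smul_rankOneMatrix, hR, ← Finset.smul_sum]
    abel

/-- On a compact set of uniformly positive matrices, Hermitian matrices decompose along finitely
many unit directions with nonnegative continuous coefficients, up to a continuous weight which is
positive on the compact set. -/
lemma exists_weighted_decomposition {K : Set (Matrix (Fin n) (Fin n) ℂ)} (hK : IsCompact K)
    {c : ℝ} (hc : 0 < c) (hKc : ∀ A ∈ K, c • 1 ≤ A) :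
    ∃ (ι : Type) (_ : Fintype ι) (u : ι → EuclideanSpace ℂ (Fin n))
      (f : ι → Matrix (Fin n) (Fin n) ℂ → ℝ) (w : Matrix (Fin n) (Fin n) ℂ → ℝ),
      (∀ k, ‖u k‖ = 1) ∧ (∀ k, Continuous (f k)) ∧ (∀ k A, 0 ≤ f k A) ∧
      Continuous w ∧ (∀ A, 0 ≤ w A) ∧ (∀ A ∈ K, 0 < w A) ∧
      ∀ A : Matrix (Fin n) (Fin n) ℂ, A.IsHermitian →
        w A • A = ∑ k, f k A • rankOneMatrix (u k) := by
  refine hK.induction_on ?_ ?_ ?_ ?_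
  · exact ⟨Empty, inferInstance, Empty.elim, Empty.elim, 0, by simp, by simp, by simp,
      continuous_const, by simp, by simp, by simp⟩
  · rintro s t hst ⟨ι, _, u, f, w, hu, hf, hf0, hw, hw0, hwt, h⟩
    exact ⟨ι, inferInstance, u, f, w, hu, hf, hf0, hw, hw0, fun A hA => hwt A (hst hA), h⟩
  · rintro s t ⟨ι, _, u, f, w, hu, hf, hf0, hw, hw0, hws, h⟩
      ⟨ι', _, u', f', w', hu', hf', hf0', hw', hw0', hwt, h'⟩
    refine ⟨ι ⊕ ι', inferInstance, Sum.elim u u', Sum.elim f f', fun A => w A + w' A,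
      by simp [hu, hu'], by simp [hf, hf'], by simp [hf0, hf0'], hw.add hw',
      fun A => add_nonneg (hw0 A) (hw0' A), ?_, ?_⟩
    · rintro A (hA | hA)
      · exact add_pos_of_pos_of_nonneg (hws A hA) (hw0' A)
      · exact add_pos_of_nonneg_of_pos (hw0 A) (hwt A hA)
    · intro A hA
      simp [add_smul, h A hA, h' A hA]
  · intro A₀ hA₀
    obtain ⟨ι, _, u, f, hu, hf, hf0, h⟩ := exists_pos_coefficients_at hc (hKc A₀ hA₀)
    set w : Matrix (Fin n) (Fin n) ℂ → ℝ := fun A => ∏ k, max 0 (f k A)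
    have hw : Continuous w := continuous_finsetProd _ fun k _ => continuous_const.max (hf k)
    have hw0 : ∀ A, 0 ≤ w A := fun A => Finset.prod_nonneg fun k _ => le_max_left _ _
    have hwA₀ : 0 < w A₀ := Finset.prod_pos fun k _ => lt_max_of_lt_right (hf0 k)
    refine ⟨{A | 0 < w A}, mem_nhdsWithin_of_mem_nhds
      ((isOpen_lt continuous_const hw).mem_nhds hwA₀), ι, inferInstance, u,
      fun k A => w A * f k A, w, hu, fun k => hw.mul (hf k), ?_, hw, hw0, fun A hA => hA, ?_⟩
    · intro k A
      rcases le_or_gt 0 (f k A) with hk | hk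
      · exact mul_nonneg (hw0 A) hk
      · have : w A = 0 := Finset.prod_eq_zero (Finset.mem_univ k) (max_eq_left hk.le)
        simp [this]
    · intro A hA
      simp only [mul_smul]
      rw [← Finset.smul_sum, ← h A hA]

lemma isCompact_Icc_smul_one {c C : ℝ} (hc : 0 < c) :
    IsCompact (Set.Icc (c • (1 : Matrix (Fin n) (Fin n) ℂ)) (C • 1)) := by
  refine Metric.isCompact_of_isClosed_isBounded isClosed_Icc
    (isBounded_iff_forall_norm_le.2 ⟨‖C • (1 : Matrix (Fin n) (Fin n) ℂ)‖, fun A hA => ?_⟩)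
  exact CStarAlgebra.norm_le_norm_of_nonneg_of_le
    ((smul_nonneg hc.le zero_le_one).trans hA.1) hA.2

/-- On the order interval `[c, C]`, matrices decompose along finitely many unit directions with
nonnegative continuous bounded coefficients. -/
lemma exists_nonneg_decomposition (n : ℕ) {c : ℝ} (C : ℝ) (hc : 0 < c) :
    ∃ (ι : Type) (_ : Fintype ι) (u : ι → EuclideanSpace ℂ (Fin n))
      (f : ι → Matrix (Fin n) (Fin n) ℂ → ℝ) (M : ℝ), (∀ k, ‖u k‖ = 1) ∧
      (∀ k, ContinuousOn (f k) (Set.Icc (c • 1) (C • 1))) ∧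
      ∀ A ∈ Set.Icc (c • (1 : Matrix (Fin n) (Fin n) ℂ)) (C • 1),
        (∀ k, 0 ≤ f k A ∧ f k A ≤ M) ∧ A = ∑ k, f k A • rankOneMatrix (u k) := by
  have hK := isCompact_Icc_smul_one (n := n) (C := C) hc
  obtain ⟨ι, _, u, f, w, hu, hf, hf0, hw, hw0, hwK, h⟩ :=
    exists_weighted_decomposition hK hc fun A hA => hA.1
  have hcont : ∀ k, ContinuousOn (fun A => (w A)⁻¹ * f k A)
      (Set.Icc (c • (1 : Matrix (Fin n) (Fin n) ℂ)) (C • 1)) := fun k =>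
    (hw.continuousOn.inv₀ fun A hA => (hwK A hA).ne').mul (hf k).continuousOn
  choose M hM using fun k => hK.exists_bound_of_continuousOn (hcont k)
  refine ⟨ι, inferInstance, u, fun k A => (w A)⁻¹ * f k A, ∑ k, |M k|, hu, hcont,
    fun A hA => ⟨fun k => ⟨mul_nonneg (inv_nonneg.2 (hw0 A)) (hf0 k A), ?_⟩, ?_⟩⟩
  · calc _ ≤ M k := (le_abs_self _).trans (hM k A hA)
      _ ≤ |M k| := le_abs_self _
      _ ≤ _ := Finset.single_le_sum (f := fun k => |M k|) (fun _ _ => abs_nonneg _)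
        (Finset.mem_univ k)
  · simp only [mul_smul]
    rw [← Finset.smul_sum, ← h A (isHermitian_of_smul_one_le hA.1),
      inv_smul_smul₀ (hwK A hA).ne']

/-- On the order interval `[c, C]`, matrices decompose along finitely many unit directions
containing the standard basis, with coefficients in a compact interval of positive reals. -/
lemma exists_pos_decomposition (n : ℕ) {c C : ℝ} (hc : 0 < c) :
    ∃ (ι : Type) (_ : Fintype ι) (u : ι ⊕ Fin n → EuclideanSpace ℂ (Fin n))
      (f : ι ⊕ Fin n → Matrix (Fin n) (Fin n) ℂ → ℝ) (C₁ C₂ : ℝ), 0 < C₁ ∧ C₁ ≤ C₂ ∧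
      (∀ k, ‖u k‖ = 1) ∧ (Orthonormal ℂ fun i => u (Sum.inr i)) ∧
      (∀ k, ContinuousOn (f k) {A | (A - c • 1).PosSemidef ∧ (C • 1 - A).PosSemidef}) ∧
      ∀ A : Matrix (Fin n) (Fin n) ℂ, (A - c • 1).PosSemidef → (C • 1 - A).PosSemidef →
        (∀ k, C₁ ≤ f k A ∧ f k A ≤ C₂) ∧ A = ∑ k, f k A • rankOneMatrix (u k) := by
  obtain ⟨ι, _, u, f, M, hu, hf, h⟩ := exists_nonneg_decomposition n C (half_pos hc)
  let v : ι ⊕ Fin n → EuclideanSpace ℂ (Fin n) := Sum.elim u (EuclideanSpace.basisFun (Fin n) ℂ)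
  have hv : ∀ k, ‖v k‖ = 1 := by
    rintro (k | k)
    · exact hu k
    · exact (EuclideanSpace.basisFun (Fin n) ℂ).orthonormal.1 k
  set δ : ℝ := c / 2 / (Fintype.card (ι ⊕ Fin n) + 1)
  have hδ0 : 0 < δ := by positivity
  let Q := δ • ∑ k, rankOneMatrix (v k)
  have hQ : 0 ≤ Q := smul_nonneg hδ0.le
    (Finset.sum_nonneg fun k _ => (isStarProjection_rankOneMatrix (hv k)).nonneg)
  have hQ' : Q ≤ (c / 2) • 1 := sum_rankOneMatrix_le hv (half_pos hc)
  have hmaps : ∀ A : Matrix (Fin n) (Fin n) ℂ, (A - c • 1).PosSemidef → (C • 1 - A).PosSemidef →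
      A - Q ∈ Set.Icc ((c / 2) • (1 : Matrix (Fin n) (Fin n) ℂ)) (C • 1) := by
    intro A h1 h2
    refine ⟨?_, (sub_le_self A hQ).trans (Matrix.le_iff.2 h2)⟩
    rw [le_sub_iff_add_le]
    calc _ ≤ (c / 2) • 1 + (c / 2) • (1 : Matrix (Fin n) (Fin n) ℂ) := add_le_add_right hQ' _
      _ = c • 1 := by rw [← add_smul, add_halves]
      _ ≤ A := Matrix.le_iff.2 h1
  refine ⟨ι, inferInstance, v, Sum.elim (fun k A => δ + f k (A - Q)) (fun _ _ => δ), δ, δ + |M|,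
    hδ0, by simp, hv, (EuclideanSpace.basisFun (Fin n) ℂ).orthonormal, ?_, ?_⟩
  · rintro (k | k)
    · exact continuousOn_const.add ((hf k).comp (continuous_id.sub continuous_const).continuousOn
        fun A hA => hmaps A hA.1 hA.2)
    · exact continuousOn_const
  · intro A h1 h2
    obtain ⟨hb, hsum⟩ := h _ (hmaps A h1 h2)
    refine ⟨?_, ?_⟩
    · rintro (k | k)
      · exact ⟨by simpa using (hb k).1, by simpa using (hb k).2.trans (le_abs_self M)⟩
      · simp
    · rw [← sub_add_cancel A Q]
      conv_lhs => rw [hsum]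
      simp only [sub_add_cancel, Q, Fintype.sum_sum_type, Sum.elim_inl, Sum.elim_inr, add_smul,
        Finset.sum_add_distrib, Finset.smul_sum, v]
      abel

end RankOneDecomposition

/-- Decomposition of a uniformly elliptic continuous Hermitian coefficient
matrix `[F^{i j̄}(y)]` into a positive combination, with uniformly bounded
continuous coefficients, of rank-one projections `γ_k γ_k^*` along finitely many
fixed unit directions containing an orthonormal basis of `ℂⁿ`. -/
theorem stmt_9 (n : ℕ) (hn : 1 ≤ n) (U : Type*) [TopologicalSpace U]
    (F : U → Matrix (Fin n) (Fin n) ℂ) (hFc : Continuous F)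
    (hFherm : ∀ y, (F y).IsHermitian)
    (c C : ℝ) (hc : 0 < c) (hC : c ≤ C)
    (hlow : ∀ y, (F y - c • (1 : Matrix (Fin n) (Fin n) ℂ)).PosSemidef)
    (hupp : ∀ y, ((C • (1 : Matrix (Fin n) (Fin n) ℂ)) - F y).PosSemidef) :
    ∃ (N : ℕ) (γ : Fin N → EuclideanSpace ℂ (Fin n)) (τ : Fin N → U → ℝ)
      (C₁ C₂ : ℝ), 0 < C₁ ∧ C₁ ≤ C₂ ∧
      (∀ k, ‖γ k‖ = 1) ∧
      (∃ b : Fin n → Fin N, Orthonormal ℂ (fun i => γ (b i))) ∧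
      (∀ k, Continuous (τ k)) ∧
      (∀ k y, C₁ ≤ τ k y ∧ τ k y ≤ C₂) ∧
      (∀ y i j, F y i j =
        ∑ k : Fin N, (τ k y : ℂ) * (γ k i * (starRingEnd ℂ) (γ k j))) := by
  obtain ⟨ι, _, u, f, C₁, C₂, hC₁, hC₁₂, hu, hb, hf, h⟩ :=
    exists_pos_decomposition n (C := C) hc
  let e := Fintype.equivFin (ι ⊕ Fin n)
  refine ⟨_, fun k => u (e.symm k), fun k y => f (e.symm k) (F y), C₁, C₂, hC₁, hC₁₂,
    fun k => hu _, ⟨fun i => e (Sum.inr i), by simpa using hb⟩,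
    fun k => (hf _).comp_continuous hFc fun y => ⟨hlow y, hupp y⟩,
    fun k y => (h (F y) (hlow y) (hupp y)).1 _, fun y i j => ?_⟩
  rw [e.symm.sum_comp fun k => (f k (F y) : ℂ) * (u k i * (starRingEnd ℂ) (u k j))]
  conv_lhs => rw [(h (F y) (hlow y) (hupp y)).2]
  simp [Matrix.sum_apply, rankOneMatrix_apply]
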